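/- arXiv:1612.01932 — 2 statements merged into one kernel-verified Lean document; each statement's English description precedes it below -/
import Mathlib

section
/- Let w be a weight on ℝ and let δ > 1. Assume the one-sided Fujii–Wilson condition with constant δ: for every bounded interval J, ∫_J M⁻(w·1_J) dx ≤ δ·w(J). Then for every r with 1 ≤ r < δ/(δ−1): (a) for every bounded interval (a,b), ∫_{(a,b)} M⁻(w·1_{(a,b)})ʳ dx ≤ δ · (r′−1)/(r′−δ) · (M⁻(w·1_{(a,b)})(b))^{r−1} · w((a,b)); and (b) for all real numbers a < b < c, (c−b)^{r−1} · ∫_{(a,b)} M⁻(w·1_{(a,b)})ʳ dx ≤ δ · (r′−1)/(r′−δ) · w((a,c))ʳ. -/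
open MeasureTheory Set ENNReal

noncomputable section

/-- The one-sided (backward) Hardy–Littlewood maximal operator on `ℝ`:
`M⁻f(x) = sup_{h>0} (1/h) ∫_{x-h}^x |f|`. -/
def Mminus (f : ℝ → ℝ) (x : ℝ) : ℝ≥0∞ :=
  ⨆ (h : ℝ) (_ : 0 < h),
    (∫⁻ y in Set.Ioo (x - h) x, ENNReal.ofReal |f y|) / ENNReal.ofReal h


/-- A bounded open subset of `ℝ` is a countable disjoint union of open intervals whose endpoints
lie outside it. -/
lemma exists_countable_disjoint_Ioo {S : Set ℝ} {a b : ℝ} (hS : IsOpen S) (hab : S ⊆ Ioo a b) :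
    ∃ T : Set (ℝ × ℝ), T.Countable ∧ T.PairwiseDisjoint (fun p => Ioo p.1 p.2) ∧
      S = (⋃ p ∈ T, Ioo p.1 p.2) ∧
      ∀ p ∈ T, p.1 < p.2 ∧ p.1 ∉ S ∧ p.2 ∉ S ∧ a ≤ p.1 ∧ p.2 ≤ b := by
  set T : Set (ℝ × ℝ) := {p | p.1 < p.2 ∧ p.1 ∉ S ∧ p.2 ∉ S ∧ Ioo p.1 p.2 ⊆ S}
  have hdisj : T.PairwiseDisjoint (fun p => Ioo p.1 p.2) := by
    intro p hp q hq hne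
    refine Set.disjoint_left.2 fun x hxp hxq => hne ?_
    obtain ⟨-, hp1, hp2, hpS⟩ := hp
    obtain ⟨-, hq1, hq2, hqS⟩ := hq
    refine Prod.ext ?_ ?_
    · rcases lt_trichotomy p.1 q.1 with h | h | h
      · exact absurd (hpS ⟨h, hxq.1.trans hxp.2⟩) hq1
      · exact h
      · exact absurd (hqS ⟨h, hxp.1.trans hxq.2⟩) hp1
    · rcases lt_trichotomy p.2 q.2 with h | h | h
      · exact absurd (hqS ⟨hxq.1.trans hxp.2, h⟩) hp2
      · exact h
      · exact absurd (hpS ⟨hxp.1.trans hxq.2, h⟩) hq2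
  refine ⟨T, hdisj.countable_of_isOpen (fun _ _ => isOpen_Ioo)
    (fun p hp => nonempty_Ioo.2 hp.1), hdisj, ?_, ?_⟩
  · refine subset_antisymm (fun x hx => ?_) (iUnion₂_subset fun p hp => hp.2.2.2)
    have hax := hab hx
    have hclL : IsClosed (Sᶜ ∩ Iic x) := hS.isClosed_compl.inter isClosed_Iic
    have hclR : IsClosed (Sᶜ ∩ Ici x) := hS.isClosed_compl.inter isClosed_Ici
    have hbL : BddAbove (Sᶜ ∩ Iic x) := ⟨x, fun y hy => hy.2⟩
    have hbR : BddBelow (Sᶜ ∩ Ici x) := ⟨x, fun y hy => hy.2⟩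
    have hL := hclL.csSup_mem ⟨a, fun h => lt_irrefl _ (hab h).1, hax.1.le⟩ hbL
    have hR := hclR.csInf_mem ⟨b, fun h => lt_irrefl _ (hab h).2, hax.2.le⟩ hbR
    set α := sSup (Sᶜ ∩ Iic x)
    set β := sInf (Sᶜ ∩ Ici x)
    have hαx : α < x := lt_of_le_of_ne hL.2 fun h => hL.1 (h ▸ hx)
    have hxβ : x < β := lt_of_le_of_ne hR.2 fun h => hR.1 (h ▸ hx)
    refine mem_iUnion₂.2 ⟨(α, β), ⟨hαx.trans hxβ, hL.1, hR.1, fun y hy => ?_⟩, hαx, hxβ⟩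
    by_contra hyS
    rcases le_total y x with h | h
    · exact (hy.1.trans_le (le_csSup hbL ⟨hyS, h⟩)).false
    · exact (hy.2.trans_le (csInf_le hbR ⟨hyS, h⟩)).false
  · intro p hp
    obtain ⟨hlt, h1, h2, hsub⟩ := hp
    have hcl := closure_mono (hsub.trans hab)
    have hlt' : a < b := by
      obtain ⟨x, hx⟩ := nonempty_Ioo.2 hlt
      exact (hab (hsub hx)).1.trans (hab (hsub hx)).2
    rw [closure_Ioo hlt.ne, closure_Ioo hlt'.ne] at hcl
    exact ⟨hlt, h1, h2, (hcl (left_mem_Icc.2 hlt.le)).1, (hcl (right_mem_Icc.2 hlt.le)).2⟩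

lemma Mminus_mono {f g : ℝ → ℝ} (h : ∀ x, |f x| ≤ |g x|) (x : ℝ) : Mminus f x ≤ Mminus g x := by
  exact iSup₂_mono fun _ _ => ENNReal.div_le_div_right
    (lintegral_mono fun y => ENNReal.ofReal_le_ofReal (h y)) _

section Primitive

variable {f : ℝ → ℝ}

lemma lintegral_Ioo_eq_primitive (hf : Integrable f) (h0 : ∀ x, 0 ≤ f x) {y x : ℝ} (hyx : y ≤ x) :
    (∫⁻ t in Ioo y x, ENNReal.ofReal |f t|) =
      ENNReal.ofReal ((∫ t in (0 : ℝ)..x, f t) - ∫ t in (0 : ℝ)..y, f t) := by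
  rw [intervalIntegral.integral_interval_sub_left hf.intervalIntegrable hf.intervalIntegrable,
    intervalIntegral.integral_of_le hyx, integral_Ioc_eq_integral_Ioo,
    ofReal_integral_eq_lintegral_ofReal hf.integrableOn (ae_of_all _ h0)]
  simp only [abs_of_nonneg (h0 _)]

lemma primitive_mono (hf : Integrable f) (h0 : ∀ x, 0 ≤ f x) :
    Monotone fun x => ∫ t in (0 : ℝ)..x, f t := by
  intro y x hyx
  have := intervalIntegral.integral_interval_sub_left (μ := volume) (a := 0) (b := x) (c := y)
    hf.intervalIntegrable hf.intervalIntegrable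
  have h2 := intervalIntegral.integral_nonneg (μ := volume) hyx fun t _ => h0 t
  simp only
  linarith

lemma continuous_primitive_zero (hf : Integrable f) :
    Continuous fun x => ∫ t in (0 : ℝ)..x, f t :=
  intervalIntegral.continuous_primitive (fun _ _ => hf.intervalIntegrable) 0

lemma lowerSemicontinuous_Mminus (hf : Integrable f) (h0 : ∀ x, 0 ≤ f x) :
    LowerSemicontinuous (Mminus f) := by
  unfold Mminus
  refine lowerSemicontinuous_biSup fun h hh => Continuous.lowerSemicontinuous ?_
  have hc := continuous_primitive_zero hf
  have : (fun x => (∫⁻ y in Ioo (x - h) x, ENNReal.ofReal |f y|) / ENNReal.ofReal h) =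
      fun x => ENNReal.ofReal ((∫ t in (0 : ℝ)..x, f t) - ∫ t in (0 : ℝ)..(x - h), f t) /
        ENNReal.ofReal h := by
    funext x
    rw [lintegral_Ioo_eq_primitive hf h0 (by linarith)]
  rw [this]
  refine ENNReal.continuous_div_const _ (by simpa using hh) |>.comp ?_
  exact ENNReal.continuous_ofReal.comp (hc.sub (hc.comp (continuous_id.sub continuous_const)))

lemma Mminus_le_ofReal_iff (hf : Integrable f) (h0 : ∀ x, 0 ≤ f x) {l : ℝ} (hl : 0 ≤ l) (x : ℝ) :
    Mminus f x ≤ ENNReal.ofReal l ↔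
      ∀ y < x, (∫ t in (0 : ℝ)..x, f t) - (∫ t in (0 : ℝ)..y, f t) ≤ l * (x - y) := by
  have key : ∀ h > 0, ((∫⁻ y in Ioo (x - h) x, ENNReal.ofReal |f y|) / ENNReal.ofReal h ≤
      ENNReal.ofReal l ↔
        (∫ t in (0 : ℝ)..x, f t) - (∫ t in (0 : ℝ)..(x - h), f t) ≤ l * h) := by
    intro h hh
    rw [lintegral_Ioo_eq_primitive hf h0 (by linarith), ← ENNReal.ofReal_div_of_pos hh,
      ENNReal.ofReal_le_ofReal_iff hl, div_le_iff₀ hh]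
  simp only [Mminus, iSup_le_iff]
  constructor
  · intro H y hy
    simpa using (key (x - y) (by linarith)).1 (H (x - y) (by linarith))
  · intro H h hh
    refine (key h hh).2 ?_
    simpa using H (x - h) (by linarith)

/-- The rising sun lemma on an interval of a superlevel set of `M⁻f`. -/
lemma mul_le_primitive_sub (hf : Integrable f) (h0 : ∀ x, 0 ≤ f x) {l : ℝ} (hl : 0 ≤ l)
    {α x : ℝ} (hαx : α ≤ x) (hα : Mminus f α ≤ ENNReal.ofReal l)
    (hS : ∀ z ∈ Ioc α x, ENNReal.ofReal l < Mminus f z) :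
    l * (x - α) ≤ (∫ t in (0 : ℝ)..x, f t) - ∫ t in (0 : ℝ)..α, f t := by
  have hα' := (Mminus_le_ofReal_iff hf h0 hl α).1 hα
  have hS' : ∀ z ∈ Ioc α x, ∃ y < z,
      l * (z - y) < (∫ t in (0 : ℝ)..z, f t) - ∫ t in (0 : ℝ)..y, f t := by
    intro z hz
    by_contra! hcon
    exact (hS z hz).not_ge ((Mminus_le_ofReal_iff hf h0 hl z).2 hcon)
  have hc := continuous_primitive_zero hf
  set F := fun x => ∫ t in (0 : ℝ)..x, f t
  change l * (x - α) ≤ F x - F α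
  obtain ⟨z, hz, hmin⟩ := isCompact_Icc.exists_isMinOn (nonempty_Icc.2 hαx)
    (f := fun y => F y - l * y) (by fun_prop)
  have hzx : F z - l * z ≤ F x - l * x := hmin (right_mem_Icc.2 hαx)
  rcases eq_or_lt_of_le hz.1 with rfl | hlt
  · linarith
  obtain ⟨y, hyz, hy⟩ := hS' z ⟨hlt, hz.2⟩
  change l * (z - y) < F z - F y at hy
  rcases lt_or_ge y α with hyα | hyα
  · have : F α - F y ≤ l * (α - y) := hα' y hyα
    linarith
  · have : F z - l * z ≤ F y - l * y := hmin ⟨hyα, hyz.le.trans hz.2⟩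
    linarith

/-- On an interval of a superlevel set of `M⁻f` whose left endpoint is not in that set, `M⁻f`
only depends on the values of `f` on the interval. -/
lemma Mminus_le_of_eqOn {g : ℝ → ℝ} (hf : Integrable f) (h0 : ∀ x, 0 ≤ f x) {l : ℝ} (hl : 0 ≤ l)
    {α β : ℝ} (hα : Mminus f α ≤ ENNReal.ofReal l)
    (hS : ∀ z ∈ Ioo α β, ENNReal.ofReal l < Mminus f z) (hfg : EqOn f g (Ioo α β))
    {x : ℝ} (hx : x ∈ Ioo α β) : Mminus f x ≤ Mminus g x := by
  have hloc : ∀ h, 0 < h → h ≤ x - α →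
      (∫⁻ y in Ioo (x - h) x, ENNReal.ofReal |f y|) / ENNReal.ofReal h ≤ Mminus g x := by
    intro h hh hle
    have : (∫⁻ y in Ioo (x - h) x, ENNReal.ofReal |f y|) =
        ∫⁻ y in Ioo (x - h) x, ENNReal.ofReal |g y| :=
      setLIntegral_congr_fun measurableSet_Ioo fun y hy => by
        simp only [hfg ⟨by linarith [hy.1], hy.2.trans hx.2⟩]
    rw [this]
    exact le_iSup₂ (f := fun (h : ℝ) (_ : 0 < h) =>
      (∫⁻ y in Ioo (x - h) x, ENNReal.ofReal |g y|) / ENNReal.ofReal h) h hh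
  refine iSup₂_le fun h hh => ?_
  rcases le_or_gt h (x - α) with hle | hgt
  · exact hloc h hh hle
  have hpos : 0 < x - α := sub_pos.2 hx.1
  refine le_trans ?_ (hloc (x - α) hpos le_rfl)
  have h1 := mul_le_primitive_sub hf h0 hl hx.1.le hα fun z hz => hS z ⟨hz.1, hz.2.trans_lt hx.2⟩
  have h2 := (Mminus_le_ofReal_iff hf h0 hl α).1 hα (x - h) (by linarith)
  have hxα : x - (x - α) = α := by ring
  rw [lintegral_Ioo_eq_primitive hf h0 (by linarith),
    lintegral_Ioo_eq_primitive hf h0 (by linarith),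
    ← ENNReal.ofReal_div_of_pos hh, ← ENNReal.ofReal_div_of_pos hpos, hxα]
  apply ENNReal.ofReal_le_ofReal
  rw [div_le_div_iff₀ hh hpos]
  nlinarith [mul_le_mul_of_nonneg_right h2 hpos.le,
    mul_le_mul_of_nonneg_right h1 (sub_nonneg.2 hgt.le)]

end Primitive

lemma integrable_indicator_Ioo {w : ℝ → ℝ} (hloc : LocallyIntegrable w volume) (a b : ℝ) :
    Integrable ((Ioo a b).indicator w) :=
  (integrable_indicator_iff measurableSet_Ioo).2
    ((hloc.integrableOn_isCompact isCompact_Icc).mono_set Ioo_subset_Icc_self)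

lemma Mminus_indicator_Ioo_left (w : ℝ → ℝ) (a b : ℝ) :
    Mminus ((Ioo a b).indicator w) a = 0 := by
  simp only [Mminus, ENNReal.iSup_eq_zero]
  intro h _
  have : (∫⁻ y in Ioo (a - h) a, ENNReal.ofReal |(Ioo a b).indicator w y|) = 0 := by
    rw [setLIntegral_congr_fun (g := fun _ => 0) measurableSet_Ioo, lintegral_zero]
    intro y hy
    have : y ∉ Ioo a b := fun hy' => hy.2.not_gt hy'.1
    simp [this]
  simp [this]

/-- The Fujii–Wilson condition gives a reverse weak-type estimate for `M⁻` on its superlevel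
sets. -/
lemma setLIntegral_Mminus_superlevel_le {w : ℝ → ℝ} (hw : ∀ x, 0 ≤ w x)
    (hloc : LocallyIntegrable w volume) {δ : ℝ}
    (hFW : ∀ a b : ℝ, a < b →
      (∫⁻ x in Ioo a b, Mminus ((Ioo a b).indicator w) x) ≤
        ENNReal.ofReal δ * ∫⁻ x in Ioo a b, ENNReal.ofReal (w x))
    {a b l : ℝ} (hl : 0 ≤ l) (hb : Mminus ((Ioo a b).indicator w) b ≤ ENNReal.ofReal l) :
    (∫⁻ x in Ioo a b ∩ {x | ENNReal.ofReal l < Mminus ((Ioo a b).indicator w) x},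
        Mminus ((Ioo a b).indicator w) x) ≤
      ENNReal.ofReal δ * (ENNReal.ofReal l *
        volume (Ioo a b ∩ {x | ENNReal.ofReal l < Mminus ((Ioo a b).indicator w) x})) := by
  set f := (Ioo a b).indicator w with hf_def
  have hf : Integrable f := integrable_indicator_Ioo hloc a b
  have h0 : ∀ x, 0 ≤ f x := indicator_nonneg fun x _ => hw x
  set S := Ioo a b ∩ {x | ENNReal.ofReal l < Mminus f x} with hS
  have hSo : IsOpen S :=
    isOpen_Ioo.inter ((lowerSemicontinuous_Mminus hf h0).isOpen_preimage _)
  obtain ⟨T, hTc, hTd, hST, hT⟩ := exists_countable_disjoint_Ioo hSo inter_subset_left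
  rw [hST, lintegral_biUnion hTc (fun _ _ => measurableSet_Ioo) hTd,
    measure_biUnion hTc hTd (fun _ _ => measurableSet_Ioo), ← ENNReal.tsum_mul_left,
    ← ENNReal.tsum_mul_left]
  refine ENNReal.tsum_le_tsum fun p => ?_
  obtain ⟨⟨α, β⟩, hp⟩ := p
  obtain ⟨hlt, hα, hβ, haα, hβb⟩ := hT _ hp
  simp only at hlt hα hβ haα hβb ⊢
  have hsub : Ioo α β ⊆ S := hST ▸ subset_biUnion_of_mem (u := fun p : ℝ × ℝ => Ioo p.1 p.2) hp
  have hMα : Mminus f α ≤ ENNReal.ofReal l := by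
    rcases haα.eq_or_lt with rfl | h
    · rw [hf_def, Mminus_indicator_Ioo_left]
      exact zero_le
    · by_contra! hcon
      exact hα ⟨⟨h, hlt.trans_le hβb⟩, hcon⟩
  have hMβ : Mminus f β ≤ ENNReal.ofReal l := by
    rcases hβb.eq_or_lt with rfl | h
    · exact hb
    · by_contra! hcon
      exact hβ ⟨⟨haα.trans_lt hlt, h⟩, hcon⟩
  have hfg : EqOn f ((Ioo α β).indicator w) (Ioo α β) := fun x hx => by
    rw [hf_def, indicator_of_mem (hsub hx).1, indicator_of_mem hx]
  calc ∫⁻ x in Ioo α β, Mminus f x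
      ≤ ∫⁻ x in Ioo α β, Mminus ((Ioo α β).indicator w) x :=
        setLIntegral_mono' measurableSet_Ioo fun x hx =>
          Mminus_le_of_eqOn hf h0 hl hMα (fun z hz => (hsub hz).2) hfg hx
    _ ≤ ENNReal.ofReal δ * ∫⁻ x in Ioo α β, ENNReal.ofReal (w x) := hFW α β hlt
    _ = ENNReal.ofReal δ * ∫⁻ x in Ioo α β, ENNReal.ofReal |f x| := by
        congr 1
        refine setLIntegral_congr_fun measurableSet_Ioo fun x hx => ?_
        simp only [abs_of_nonneg (hw x), hf_def, indicator_of_mem (hsub hx).1]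
    _ ≤ ENNReal.ofReal δ * (ENNReal.ofReal l * volume (Ioo α β)) := by
        gcongr
        rw [lintegral_Ioo_eq_primitive hf h0 hlt.le, Real.volume_Ioo, ← ENNReal.ofReal_mul hl]
        exact ENNReal.ofReal_le_ofReal ((Mminus_le_ofReal_iff hf h0 hl β).1 hMβ α hlt)

/-- A weak-type `(1, 1)` bound with constant one: if `M⁻(w·1_{(a,c)}) > l` on `(b, c)`, then
`l (c - b) ≤ w((a, c))`. -/
lemma ofReal_mul_sub_le_lintegral {w : ℝ → ℝ} (hw : ∀ x, 0 ≤ w x)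
    (hloc : LocallyIntegrable w volume) {a b c l : ℝ} (hab : a < b) (hbc : b < c) (hl : 0 ≤ l)
    (h : ∀ x ∈ Ioo b c, ENNReal.ofReal l < Mminus ((Ioo a c).indicator w) x) :
    ENNReal.ofReal (l * (c - b)) ≤ ∫⁻ x in Ioo a c, ENNReal.ofReal (w x) := by
  set f := (Ioo a c).indicator w with hf_def
  have hf : Integrable f := integrable_indicator_Ioo hloc a c
  have h0 : ∀ x, 0 ≤ f x := indicator_nonneg fun x _ => hw x
  have hW : ∫⁻ x in Ioo a c, ENNReal.ofReal (w x) = ENNReal.ofReal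
      ((∫ t in (0 : ℝ)..c, f t) - ∫ t in (0 : ℝ)..a, f t) := by
    rw [← lintegral_Ioo_eq_primitive hf h0 (hab.trans hbc).le]
    refine setLIntegral_congr_fun measurableSet_Ioo fun x hx => ?_
    simp only [abs_of_nonneg (hw x), hf_def, indicator_of_mem hx]
  rw [hW]
  apply ENNReal.ofReal_le_ofReal
  have hS' : ∀ z ∈ Ioo b c, ∃ y < z,
      l * (z - y) < (∫ t in (0 : ℝ)..z, f t) - ∫ t in (0 : ℝ)..y, f t := by
    intro z hz
    by_contra! hcon
    exact (h z hz).not_ge ((Mminus_le_ofReal_iff hf h0 hl z).2 hcon)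
  have hMa := (Mminus_le_ofReal_iff hf h0 hl a).1
    (by rw [hf_def, Mminus_indicator_Ioo_left]; exact zero_le)
  have hc := continuous_primitive_zero hf
  have hmono := primitive_mono hf h0
  set F := fun x => ∫ t in (0 : ℝ)..x, f t
  change l * (c - b) ≤ F c - F a
  have key : ∀ x ∈ Ioo b c, l * (x - b) ≤ F c - F a := by
    intro x hx
    have hax : a ≤ x := (hab.trans hx.1).le
    obtain ⟨z, hz, hmin⟩ := isCompact_Icc.exists_isMinOn (nonempty_Icc.2 hax)
      (f := fun y => F y - l * y) (by fun_prop)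
    have hzx : F z - l * z ≤ F x - l * x := hmin (right_mem_Icc.2 hax)
    have hza : F z - l * z ≤ F a - l * a := hmin (left_mem_Icc.2 hax)
    rcases le_or_gt z b with hzb | hbz
    · have h1 : F a ≤ F z := hmono hz.1
      have h2 : F x ≤ F c := hmono hx.2.le
      nlinarith
    obtain ⟨y, hyz, hy⟩ := hS' z ⟨hbz, hz.2.trans_lt hx.2⟩
    change l * (z - y) < F z - F y at hy
    rcases lt_or_ge y a with hya | hya
    · have : F a - F y ≤ l * (a - y) := hMa y hya
      linarith
    · have : F z - l * z ≤ F y - l * y := hmin ⟨hya, hyz.le.trans hz.2⟩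
      linarith
  refine le_of_tendsto (f := fun x => l * (x - b)) (x := nhdsWithin c (Iio c)) ?_
    (Filter.eventually_of_mem (Ioo_mem_nhdsLT hbc) key)
  exact ((by fun_prop : Continuous fun x => l * (x - b)).tendsto c).mono_left nhdsWithin_le_nhds

lemma ofReal_mul_lintegral_Ioc_rpow {p L : ℝ} (hp : 0 < p) (hL : 0 ≤ L) :
    ENNReal.ofReal p * ∫⁻ t in Ioc 0 L, ENNReal.ofReal (t ^ (p - 1)) = ENNReal.ofReal (L ^ p) := by
  have hint : IntervalIntegrable (fun t : ℝ => t ^ (p - 1)) volume 0 L :=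
    intervalIntegral.intervalIntegrable_rpow' (by linarith)
  rw [← ofReal_integral_eq_lintegral_ofReal ((intervalIntegrable_iff_integrableOn_Ioc_of_le hL).1
      hint) ((ae_restrict_iff' measurableSet_Ioc).2 (ae_of_all _ fun t ht =>
        Real.rpow_nonneg ht.1.le _)), ← intervalIntegral.integral_of_le hL,
    integral_rpow (Or.inl (by linarith)), ← ENNReal.ofReal_mul hp.le, sub_add_cancel,
    Real.zero_rpow hp.ne', sub_zero, mul_div_cancel₀ _ hp.ne']

/-- Absorbing the multiple of `X` hidden in `B` into the left-hand side of `hXV`. -/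
lemma ofReal_mul_le_of_absorption {L r δ : ℝ} (hL : 0 ≤ L) (hr : 1 < r) (hδ : 0 ≤ δ)
    (hrδ : 0 ≤ r - δ * (r - 1)) {V m X B : ℝ≥0∞} (hV : V ≠ ∞) (hm : m ≠ ∞) (hX : X ≠ ∞) (hB : B ≠ ∞)
    (hVm : V ≤ ENNReal.ofReal δ * (ENNReal.ofReal L * m))
    (hXV : X ≤ ENNReal.ofReal (L ^ (r - 1)) * V + ENNReal.ofReal (δ * (r - 1)) * B)
    (hBX : ENNReal.ofReal (L ^ r) * m + ENNReal.ofReal r * B ≤ X) :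
    ENNReal.ofReal (r - δ * (r - 1)) * X ≤ ENNReal.ofReal (L ^ (r - 1)) * V := by
  have hr1 : 0 < r - 1 := sub_pos.2 hr
  have hr0 : 0 < r := by linarith
  have hp : 0 ≤ L ^ (r - 1) := Real.rpow_nonneg hL _
  have hpow : L ^ r = L * L ^ (r - 1) := by
    rw [← Real.rpow_one_add' hL (by linarith), add_sub_cancel]
  rw [hpow] at hBX
  generalize L ^ (r - 1) = P at *
  lift V to NNReal using hV
  lift m to NNReal using hm
  lift X to NNReal using hX
  lift B to NNReal using hB
  lift L to NNReal using hL
  lift P to NNReal using hp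
  lift δ to NNReal using hδ
  obtain ⟨q, hq⟩ : ∃ q : NNReal, (q : ℝ) = r - 1 := ⟨⟨r - 1, hr1.le⟩, rfl⟩
  obtain ⟨c, hc⟩ : ∃ c : NNReal, (c : ℝ) = r - δ * (r - 1) := ⟨⟨_, hrδ⟩, rfl⟩
  lift r to NNReal using hr0.le
  rw [← hc]
  rw [← hq] at hXV
  simp only [← NNReal.coe_mul, ENNReal.ofReal_coe_nnreal] at *
  norm_cast at hVm hXV hBX ⊢
  rw [← NNReal.coe_le_coe] at hVm hXV hBX ⊢
  push_cast at hVm hXV hBX ⊢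
  have hV0 : (0 : ℝ) ≤ P * q := by positivity
  have h1 := mul_le_mul_of_nonneg_left hVm hV0
  have h2 := mul_le_mul_of_nonneg_left hXV r.coe_nonneg
  have h3 := mul_le_mul_of_nonneg_left hBX (mul_nonneg δ.coe_nonneg q.coe_nonneg)
  rw [hc, ← hq]
  have hrq : (r : ℝ) = q + 1 := by linarith
  rw [hrq] at h2 h3 ⊢
  linarith

section ReverseWeakType

variable {α : Type*} [MeasurableSpace α] {μ : Measure α} {M : α → ℝ≥0∞} {L r δ : ℝ}

lemma lintegral_mul_min_rpow_le [IsFiniteMeasure μ] (hM : Measurable M) (hL : 0 ≤ L) (hr : 1 < r)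
    (hδ : 0 ≤ δ) (hLM : ∀ᵐ x ∂μ, ENNReal.ofReal L < M x)
    (h : ∀ t, L ≤ t → (∫⁻ x in {x | ENNReal.ofReal t < M x}, M x ∂μ) ≤
      ENNReal.ofReal δ * (ENNReal.ofReal t * μ {x | ENNReal.ofReal t < M x}))
    (hrδ : 0 ≤ r - δ * (r - 1)) {K : ℝ} (hK : L < K) :
    ENNReal.ofReal (r - δ * (r - 1)) * ∫⁻ x, M x * (min (M x) (ENNReal.ofReal K)) ^ (r - 1) ∂μ ≤
      ENNReal.ofReal (L ^ (r - 1)) * ∫⁻ x, M x ∂μ := by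
  have hr1 : 0 < r - 1 := sub_pos.2 hr
  have hr0 : 0 < r := by linarith
  have hK0 : 0 < K := hL.trans_lt hK
  set N : α → ℝ := fun x => (min (M x) (ENNReal.ofReal K)).toReal with hN
  have hfin : ∀ x, min (M x) (ENNReal.ofReal K) ≠ ∞ := fun x =>
    ne_top_of_le_ne_top ENNReal.ofReal_ne_top (min_le_right _ _)
  have hNm : Measurable N := (hM.min measurable_const).ennreal_toReal
  have hN0 : ∀ x, 0 ≤ N x := fun x => ENNReal.toReal_nonneg
  have hNofReal : ∀ x, ENNReal.ofReal (N x) = min (M x) (ENNReal.ofReal K) := fun x =>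
    ENNReal.ofReal_toReal (hfin x)
  have hNpow : ∀ (q : ℝ), 0 ≤ q → ∀ x,
      ENNReal.ofReal (N x ^ q) = (min (M x) (ENNReal.ofReal K)) ^ q := fun q hq x => by
    rw [← ENNReal.ofReal_rpow_of_nonneg (hN0 x) hq, hNofReal]
  have hlt : ∀ t, 0 ≤ t → ∀ x, t < N x ↔ ENNReal.ofReal t < M x ∧ t < K := by
    intro t ht x
    rw [hN, ← ENNReal.ofReal_lt_iff_lt_toReal ht (hfin x), lt_min_iff,
      ENNReal.ofReal_lt_ofReal_iff hK0]
  have hsplit : ∀ g : ℝ → ℝ≥0∞,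
      ∫⁻ t in Ioi 0, g t = (∫⁻ t in Ioc 0 L, g t) + ∫⁻ t in Ioi L, g t := fun g => by
    rw [← lintegral_union measurableSet_Ioi (Ioc_disjoint_Ioi le_rfl), Ioc_union_Ioi_eq_Ioi hL]
  set ν := μ.withDensity M with hν
  have hνuniv : ν univ = ∫⁻ x, M x ∂μ := by rw [hν, withDensity_apply _ .univ, setLIntegral_univ]
  set B := ∫⁻ t in Ioi L, μ {x | t < N x} * ENNReal.ofReal (t ^ (r - 1)) with hB
  set X := ∫⁻ x, M x * (min (M x) (ENNReal.ofReal K)) ^ (r - 1) ∂μ with hX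
  have hfull : μ {x | ENNReal.ofReal L < M x} = μ univ :=
    measure_congr (Filter.eventuallyEq_univ.2 hLM)
  have hνμ : (∫⁻ x, M x ∂μ) ≤ ENNReal.ofReal δ * (ENNReal.ofReal L * μ univ) := by
    have := h L le_rfl
    rwa [hfull, setLIntegral_congr (Filter.eventuallyEq_univ.2 hLM), setLIntegral_univ] at this
  have hXle : X ≤ ENNReal.ofReal (L ^ (r - 1)) * (∫⁻ x, M x ∂μ) +
      ENNReal.ofReal (δ * (r - 1)) * B := by
    have hXν : X = ∫⁻ x, ENNReal.ofReal (N x ^ (r - 1)) ∂ν := by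
      rw [hν, lintegral_withDensity_eq_lintegral_mul _ hM (by fun_prop)]
      simp only [hX, Pi.mul_apply, hNpow _ hr1.le]
    rw [hXν, lintegral_rpow_eq_lintegral_meas_lt_mul ν (ae_of_all _ hN0) hNm.aemeasurable hr1,
      hsplit, mul_add]
    refine add_le_add ?_ ?_
    · rw [← hνuniv, ← ofReal_mul_lintegral_Ioc_rpow hr1 hL, mul_assoc]
      gcongr
      rw [mul_comm, ← lintegral_const_mul _ (by fun_prop)]
      gcongr
      exact subset_univ _
    · rw [mul_comm δ, ENNReal.ofReal_mul hr1.le, mul_assoc]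
      gcongr
      rw [hB, ← lintegral_const_mul' _ _ ENNReal.ofReal_ne_top]
      refine setLIntegral_mono' measurableSet_Ioi fun t (ht : L < t) => ?_
      have ht0 : 0 < t := hL.trans_lt ht
      rcases lt_or_ge t K with htK | hKt
      · have hset : {x | t < N x} = {x | ENNReal.ofReal t < M x} := by
          ext x; simp [hlt t ht0.le, htK]
        rw [hset, hν, withDensity_apply _ (measurableSet_lt measurable_const hM)]
        calc _ ≤ ENNReal.ofReal δ * (ENNReal.ofReal t * μ {x | ENNReal.ofReal t < M x}) *
              ENNReal.ofReal (t ^ (r - 1 - 1)) := by gcongr; exact h t ht.le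
          _ = ENNReal.ofReal δ * (μ {x | ENNReal.ofReal t < M x} *
              (ENNReal.ofReal t * ENNReal.ofReal (t ^ (r - 1 - 1)))) := by ring
          _ = _ := by
            rw [← ENNReal.ofReal_mul ht0.le, mul_comm t, ← Real.rpow_add_one ht0.ne',
              sub_add_cancel]
      · have hset : {x | t < N x} = ∅ := by
          ext x; simp [hlt t ht0.le, hKt]
        simp [hset]
  have hYX : ENNReal.ofReal (L ^ r) * μ univ + ENNReal.ofReal r * B ≤ X := by
    have hY : ∫⁻ x, ENNReal.ofReal (N x ^ r) ∂μ =
        ENNReal.ofReal (L ^ r) * μ univ + ENNReal.ofReal r * B := by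
      have hIoc : ∫⁻ t in Ioc 0 L, μ {x | t < N x} * ENNReal.ofReal (t ^ (r - 1)) =
          μ univ * ∫⁻ t in Ioc 0 L, ENNReal.ofReal (t ^ (r - 1)) := by
        rw [← lintegral_const_mul _ (by fun_prop)]
        refine setLIntegral_congr_fun measurableSet_Ioc fun t ht => ?_
        have : μ {x | t < N x} = μ univ :=
          measure_congr (Filter.eventuallyEq_univ.2 (hLM.mono fun x hx => (hlt t ht.1.le x).2
            ⟨(ENNReal.ofReal_le_ofReal ht.2).trans_lt hx, ht.2.trans_lt hK⟩))
        simp only [this]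
      rw [lintegral_rpow_eq_lintegral_meas_lt_mul μ (ae_of_all _ hN0) hNm.aemeasurable hr0,
        hsplit, mul_add, hIoc, ← ofReal_mul_lintegral_Ioc_rpow hr0 hL, mul_assoc,
        mul_comm (μ univ)]
    rw [← hY]
    refine lintegral_mono fun x => ?_
    simp only
    rw [hNpow r hr0.le, ← add_sub_cancel 1 r, ENNReal.rpow_add_of_nonneg _ _ zero_le_one hr1.le,
      ENNReal.rpow_one, add_sub_cancel]
    gcongr
    exact min_le_left _ _
  have hVfin : (∫⁻ x, M x ∂μ) ≠ ∞ := ne_top_of_le_ne_top (by finiteness) hνμ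
  have hXfin : X ≠ ∞ := by
    refine ne_top_of_le_ne_top (b := (∫⁻ x, M x ∂μ) * ENNReal.ofReal K ^ (r - 1)) ?_ ?_
    · exact ENNReal.mul_ne_top hVfin (ENNReal.rpow_ne_top_of_nonneg hr1.le ENNReal.ofReal_ne_top)
    · rw [hX, ← lintegral_mul_const _ hM]
      exact lintegral_mono fun x => by gcongr; exact min_le_right _ _
  have hBfin : B ≠ ∞ := by
    have h1 : ENNReal.ofReal r * B ≠ ∞ := ne_top_of_le_ne_top hXfin (le_add_self.trans hYX)
    intro hBt
    rw [hBt, ENNReal.mul_top (by simpa using hr0)] at h1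
    exact h1 rfl
  exact ofReal_mul_le_of_absorption hL hr hδ hrδ hVfin (measure_ne_top _ _) hXfin hBfin hνμ hXle hYX

lemma lintegral_rpow_le_of_reverse_weak_type [IsFiniteMeasure μ] (hM : Measurable M) (hL : 0 ≤ L)
    (hr : 1 < r) (hδ : 0 ≤ δ) (hLM : ∀ᵐ x ∂μ, ENNReal.ofReal L < M x)
    (h : ∀ t, L ≤ t → (∫⁻ x in {x | ENNReal.ofReal t < M x}, M x ∂μ) ≤
      ENNReal.ofReal δ * (ENNReal.ofReal t * μ {x | ENNReal.ofReal t < M x}))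
    (hrδ : 0 ≤ r - δ * (r - 1)) :
    ENNReal.ofReal (r - δ * (r - 1)) * ∫⁻ x, M x ^ r ∂μ ≤
      ENNReal.ofReal (L ^ (r - 1)) * ∫⁻ x, M x ∂μ := by
  have hr1 : 0 < r - 1 := sub_pos.2 hr
  have hlim : Filter.Tendsto
      (fun n : ℕ => ∫⁻ x, M x * (min (M x) (ENNReal.ofReal n)) ^ (r - 1) ∂μ) Filter.atTop
      (nhds (∫⁻ x, M x ^ r ∂μ)) := by
    refine lintegral_tendsto_of_tendsto_of_monotone (fun n => by fun_prop)
      (ae_of_all _ fun x n k hnk => ?_) (ae_of_all _ fun x => ?_)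
    · simp only
      gcongr
    · have h1 : Filter.Tendsto (fun n : ℕ => min (M x) (ENNReal.ofReal n)) Filter.atTop
          (nhds (M x)) := by
        simpa using tendsto_const_nhds.min ENNReal.tendsto_nat_nhds_top
      have h2 := ((ENNReal.continuous_rpow_const (y := r - 1)).tendsto _).comp h1
      have h3 : M x ^ r = M x * M x ^ (r - 1) := by
        conv_lhs => rw [← add_sub_cancel 1 r]
        rw [ENNReal.rpow_add_of_nonneg _ _ zero_le_one hr1.le, ENNReal.rpow_one]
      rw [h3]
      refine ENNReal.Tendsto.const_mul h2 ?_
      by_cases hx : M x = 0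
      · right; simp [hx]
      · left; simp [hx, hr.le]
  refine le_of_tendsto (ENNReal.Tendsto.const_mul hlim (Or.inr ENNReal.ofReal_ne_top)) ?_
  obtain ⟨n, hn⟩ := exists_nat_gt L
  filter_upwards [Filter.eventually_ge_atTop n] with k hk
  exact lintegral_mul_min_rpow_le hM hL hr hδ hLM h hrδ (hn.trans_le (by exact_mod_cast hk))

end ReverseWeakType

/-- The sharp reverse Hölder inequality for `M⁻(w·1_{(a,b)})` under the one-sided Fujii–Wilson
condition. -/
lemma lintegral_Mminus_rpow_le {w : ℝ → ℝ} (hw : ∀ x, 0 ≤ w x)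
    (hloc : LocallyIntegrable w volume) {δ : ℝ} (hδ : 1 < δ)
    (hFW : ∀ a b : ℝ, a < b →
      (∫⁻ x in Ioo a b, Mminus ((Ioo a b).indicator w) x) ≤
        ENNReal.ofReal δ * ∫⁻ x in Ioo a b, ENNReal.ofReal (w x))
    {r : ℝ} (hr1 : 1 ≤ r) (hr2 : r < δ / (δ - 1)) {a b : ℝ} (hab : a < b) :
    (∫⁻ x in Ioo a b, (Mminus ((Ioo a b).indicator w) x) ^ r) ≤
      ENNReal.ofReal (δ * (1 / (δ - (δ - 1) * r))) *
        (Mminus ((Ioo a b).indicator w) b) ^ (r - 1) *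
        ∫⁻ x in Ioo a b, ENNReal.ofReal (w x) := by
  rcases hr1.eq_or_lt with rfl | hr
  · simpa using hFW a b hab
  have hδ0 : 0 < δ := by linarith
  have hc : 0 < δ - (δ - 1) * r := by
    rw [lt_div_iff₀ (by linarith)] at hr2
    linarith
  have hFWab := hFW a b hab
  set f := (Ioo a b).indicator w with hf_def
  have hf : Integrable f := integrable_indicator_Ioo hloc a b
  have h0 : ∀ x, 0 ≤ f x := indicator_nonneg fun x _ => hw x
  have hM : Measurable (Mminus f) := (lowerSemicontinuous_Mminus hf h0).measurable
  by_cases hL : Mminus f b = ∞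
  · by_cases hW : ∫⁻ x in Ioo a b, ENNReal.ofReal (w x) = 0
    · rw [hW, mul_zero, nonpos_iff_eq_zero, lintegral_eq_zero_iff hM] at hFWab
      rw [hW, mul_zero, nonpos_iff_eq_zero, lintegral_eq_zero_iff (hM.pow_const r)]
      filter_upwards [hFWab] with x hx
      simp only [Pi.zero_apply] at hx ⊢
      rw [hx, ENNReal.zero_rpow_of_pos (by linarith)]
    · rw [hL, ENNReal.top_rpow_of_pos (sub_pos.2 hr), ENNReal.mul_top, ENNReal.top_mul hW]
      · exact le_top
      · simpa using by positivity
  obtain ⟨L, hL0, hLb⟩ : ∃ L : ℝ, 0 ≤ L ∧ Mminus f b = ENNReal.ofReal L :=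
    ⟨(Mminus f b).toReal, ENNReal.toReal_nonneg, (ENNReal.ofReal_toReal hL).symm⟩
  have hA : MeasurableSet {x | ENNReal.ofReal L < Mminus f x} :=
    measurableSet_lt measurable_const hM
  have : IsFiniteMeasure (volume.restrict (Ioo a b ∩ {x | ENNReal.ofReal L < Mminus f x})) :=
    isFiniteMeasure_restrict.2 (measure_ne_top_of_subset inter_subset_left (by simp))
  have hlarge := lintegral_rpow_le_of_reverse_weak_type (δ := δ)
    (μ := volume.restrict (Ioo a b ∩ {x | ENNReal.ofReal L < Mminus f x})) hM hL0 hr hδ0.le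
    (ae_restrict_of_forall_mem (measurableSet_Ioo.inter hA) fun x hx => hx.2)
    (fun t ht => by
      have hS : {x | ENNReal.ofReal t < Mminus f x} ∩
          (Ioo a b ∩ {x | ENNReal.ofReal L < Mminus f x}) =
            Ioo a b ∩ {x | ENNReal.ofReal t < Mminus f x} := by
        ext x
        simp only [mem_inter_iff, mem_ofPred_eq]
        exact ⟨fun h => ⟨h.2.1, h.1⟩,
          fun h => ⟨h.2, h.1, (ENNReal.ofReal_le_ofReal ht).trans_lt h.2⟩⟩
      have ht' : MeasurableSet {x | ENNReal.ofReal t < Mminus f x} :=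
        measurableSet_lt measurable_const hM
      rw [Measure.restrict_restrict ht', Measure.restrict_apply ht', hS]
      exact setLIntegral_Mminus_superlevel_le hw hloc hFW (hL0.trans ht)
        (hLb.trans_le (ENNReal.ofReal_le_ofReal ht)))
    (by linarith)
  have hsmall : ENNReal.ofReal (r - δ * (r - 1)) *
      (∫⁻ x in Ioo a b \ {x | ENNReal.ofReal L < Mminus f x}, Mminus f x ^ r) ≤
        ENNReal.ofReal (L ^ (r - 1)) *
          ∫⁻ x in Ioo a b \ {x | ENNReal.ofReal L < Mminus f x}, Mminus f x := by
    have h1 : ENNReal.ofReal (r - δ * (r - 1)) ≤ 1 := ENNReal.ofReal_le_one.2 (by nlinarith)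
    refine (mul_le_of_le_one_left zero_le h1).trans ?_
    rw [← lintegral_const_mul _ hM]
    refine setLIntegral_mono' (measurableSet_Ioo.diff hA) fun x hx => ?_
    have hx2 : Mminus f x ≤ ENNReal.ofReal L := not_lt.1 hx.2
    rw [← ENNReal.ofReal_rpow_of_nonneg hL0 (sub_nonneg.2 hr1)]
    calc Mminus f x ^ r = Mminus f x ^ (r - 1) * Mminus f x := by
          conv_lhs => rw [← sub_add_cancel r 1]
          rw [ENNReal.rpow_add_of_nonneg _ _ (sub_nonneg.2 hr1) zero_le_one, ENNReal.rpow_one]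
      _ ≤ _ := by gcongr
  have hall : ENNReal.ofReal (r - δ * (r - 1)) * (∫⁻ x in Ioo a b, Mminus f x ^ r) ≤
      ENNReal.ofReal (L ^ (r - 1)) * ∫⁻ x in Ioo a b, Mminus f x := by
    rw [← lintegral_inter_add_sdiff _ (Ioo a b) hA,
      ← lintegral_inter_add_sdiff (Mminus f) (Ioo a b) hA, mul_add, mul_add]
    exact add_le_add hlarge hsmall
  have hceq : r - δ * (r - 1) = δ - (δ - 1) * r := by ring
  rw [hceq] at hall
  have hcC : ENNReal.ofReal (1 / (δ - (δ - 1) * r)) * ENNReal.ofReal (δ - (δ - 1) * r) = 1 := by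
    rw [← ENNReal.ofReal_mul (by positivity), one_div_mul_cancel hc.ne', ENNReal.ofReal_one]
  rw [hLb, ENNReal.ofReal_rpow_of_nonneg hL0 (sub_nonneg.2 hr1), ENNReal.ofReal_mul hδ0.le]
  calc _ = ENNReal.ofReal (1 / (δ - (δ - 1) * r)) * (ENNReal.ofReal (δ - (δ - 1) * r) *
        ∫⁻ x in Ioo a b, Mminus f x ^ r) := by rw [← mul_assoc, hcC, one_mul]
    _ ≤ ENNReal.ofReal (1 / (δ - (δ - 1) * r)) * (ENNReal.ofReal (L ^ (r - 1)) *
        (ENNReal.ofReal δ * ∫⁻ x in Ioo a b, ENNReal.ofReal (w x))) := by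
      gcongr ENNReal.ofReal (1 / (δ - (δ - 1) * r)) * ?_
      exact hall.trans (by gcongr)
    _ = _ := by ring

/-- Practical form of the sharp reverse Hölder inequality for one-sided `A∞⁺`
weights with Fujii–Wilson constant at most `δ`.  The constant `δ(r'-1)/(r'-δ)`
is written in the equivalent form `δ/(δ-(δ-1)r)`, valid also at `r = 1`. -/
theorem stmt11 (w : ℝ → ℝ) (hw : ∀ x, 0 ≤ w x) (hloc : LocallyIntegrable w volume)
    (δ : ℝ) (hδ : 1 < δ)
    (hFW : ∀ a b : ℝ, a < b →
      (∫⁻ x in Set.Ioo a b, Mminus ((Set.Ioo a b).indicator w) x) ≤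
        ENNReal.ofReal δ * ∫⁻ x in Set.Ioo a b, ENNReal.ofReal (w x))
    (r : ℝ) (hr1 : 1 ≤ r) (hr2 : r < δ / (δ - 1)) :
    (∀ a b : ℝ, a < b →
        (∫⁻ x in Set.Ioo a b, (Mminus ((Set.Ioo a b).indicator w) x) ^ r) ≤
          ENNReal.ofReal (δ * (1 / (δ - (δ - 1) * r))) *
            (Mminus ((Set.Ioo a b).indicator w) b) ^ (r - 1) *
            ∫⁻ x in Set.Ioo a b, ENNReal.ofReal (w x)) ∧
      (∀ a b c : ℝ, a < b → b < c →
        ENNReal.ofReal ((c - b) ^ (r - 1)) *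
            ∫⁻ x in Set.Ioo a b, (Mminus ((Set.Ioo a b).indicator w) x) ^ r ≤
          ENNReal.ofReal (δ * (1 / (δ - (δ - 1) * r))) *
            (∫⁻ x in Set.Ioo a c, ENNReal.ofReal (w x)) ^ r) := by
  have hc : 0 < δ - (δ - 1) * r := by
    rw [lt_div_iff₀ (by linarith)] at hr2
    linarith
  refine ⟨fun a b hab => lintegral_Mminus_rpow_le hw hloc hδ hFW hr1 hr2 hab,
    fun a b c hab hbc => ?_⟩
  have hr0 : 0 ≤ r - 1 := sub_nonneg.2 hr1
  have hcb : 0 < c - b := sub_pos.2 hbc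
  set A := ∫⁻ x in Ioo a b, (Mminus ((Ioo a b).indicator w) x) ^ r
  set C := ENNReal.ofReal (δ * (1 / (δ - (δ - 1) * r)))
  have hWfin : ∫⁻ x in Ioo a c, ENNReal.ofReal (w x) ≠ ∞ :=
    ((hloc.integrableOn_isCompact isCompact_Icc).mono_set Ioo_subset_Icc_self).lintegral_lt_top.ne
  have hind : ∀ {u v : ℝ}, u ≤ v → ∀ y, |(Ioo a u).indicator w y| ≤ |(Ioo a v).indicator w y| := by
    intro u v huv y
    rw [abs_of_nonneg (indicator_nonneg (fun x _ => hw x) y),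
      abs_of_nonneg (indicator_nonneg (fun x _ => hw x) y)]
    exact indicator_le_indicator_of_subset (Ioo_subset_Ioo_right huv) hw y
  have hx : ∀ x ∈ Ioo b c, A ≤ C * (Mminus ((Ioo a c).indicator w) x) ^ (r - 1) *
      ∫⁻ x in Ioo a c, ENNReal.ofReal (w x) := by
    intro x hx
    calc A ≤ ∫⁻ y in Ioo a b, (Mminus ((Ioo a x).indicator w) y) ^ r := by
          refine lintegral_mono fun y => ?_
          exact ENNReal.rpow_le_rpow (Mminus_mono (hind hx.1.le) y) (by linarith)
      _ ≤ ∫⁻ y in Ioo a x, (Mminus ((Ioo a x).indicator w) y) ^ r :=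
          lintegral_mono_set (Ioo_subset_Ioo_right hx.1.le)
      _ ≤ _ := lintegral_Mminus_rpow_le hw hloc hδ hFW hr1 hr2 (hab.trans hx.1)
      _ ≤ _ := by
          gcongr
          · exact Mminus_mono (hind hx.2.le) x
          · exact hx.2.le
  obtain ⟨W, hW0, hW⟩ : ∃ W : ℝ, 0 ≤ W ∧ ∫⁻ x in Ioo a c, ENNReal.ofReal (w x) =
      ENNReal.ofReal W :=
    ⟨_, ENNReal.toReal_nonneg, (ENNReal.ofReal_toReal hWfin).symm⟩
  have hl : ∀ l ∈ Ioi (W / (c - b)), A ≤ C * ENNReal.ofReal l ^ (r - 1) * ENNReal.ofReal W := by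
    intro l (hl : W / (c - b) < l)
    have hl0 : 0 ≤ l := (div_nonneg hW0 hcb.le).trans hl.le
    obtain ⟨x, hxbc, hxl⟩ : ∃ x ∈ Ioo b c,
        Mminus ((Ioo a c).indicator w) x ≤ ENNReal.ofReal l := by
      by_contra! hcon
      have := ofReal_mul_sub_le_lintegral hw hloc hab hbc hl0 hcon
      rw [hW, ENNReal.ofReal_le_ofReal_iff hW0] at this
      rw [div_lt_iff₀ hcb] at hl
      linarith
    rw [← hW]
    exact (hx x hxbc).trans (by gcongr)
  have hcont : Continuous fun l => C * ENNReal.ofReal l ^ (r - 1) * ENNReal.ofReal W := by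
    refine (ENNReal.continuous_mul_const ENNReal.ofReal_ne_top).comp
      ((ENNReal.continuous_const_mul ENNReal.ofReal_ne_top).comp
        (ENNReal.continuous_rpow_const.comp ENNReal.continuous_ofReal))
  have hA : A ≤ C * ENNReal.ofReal (W / (c - b)) ^ (r - 1) * ENNReal.ofReal W :=
    ge_of_tendsto ((hcont.tendsto _).mono_left nhdsWithin_le_nhds)
      (Filter.eventually_of_mem self_mem_nhdsWithin hl)
  have hWr : ENNReal.ofReal ((c - b) ^ (r - 1)) *
      (ENNReal.ofReal (W / (c - b)) ^ (r - 1) * ENNReal.ofReal W) = ENNReal.ofReal W ^ r := by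
    rw [← ENNReal.ofReal_rpow_of_nonneg hcb.le hr0, ← mul_assoc,
      ← ENNReal.mul_rpow_of_nonneg _ _ hr0, ← ENNReal.ofReal_mul hcb.le,
      mul_div_cancel₀ _ hcb.ne']
    conv_rhs => rw [← sub_add_cancel r 1]
    rw [ENNReal.rpow_add_of_nonneg _ _ hr0 zero_le_one, ENNReal.rpow_one]
  rw [hW, ← hWr]
  calc _ ≤ ENNReal.ofReal ((c - b) ^ (r - 1)) *
        (C * ENNReal.ofReal (W / (c - b)) ^ (r - 1) * ENNReal.ofReal W) := by gcongr
    _ = _ := by ring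
end
end

section
/- Let w be a weight on ℝ and let δ > 1. Assume the Fujii–Wilson condition with constant δ: for every bounded interval J, ∫_J M(w·1_J) dx ≤ δ·w(J). Set r_w = δ/(δ−1). Then for every bounded interval I of positive length and every λ > 0, λ · (|{x ∈ I : M(w·1_I)(x) > λ}|/|I|)^{1/r_w} ≤ (1/|I|)∫_I M(w·1_I) dx; that is, ‖M(w·1_I)‖_{L^{r_w,∞}(I, dx/|I|)} ≤ (1/|I|)∫_I M(w·1_I) dx. -/
open MeasureTheory Set ENNReal

noncomputable section

/-- The non-centered Hardy–Littlewood maximal operator on `ℝ`, as a supremum of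
averages over bounded open intervals containing the point. -/
def M1 (f : ℝ → ℝ) (x : ℝ) : ℝ≥0∞ :=
  ⨆ (a : ℝ) (b : ℝ) (_ : a < b) (_ : x ∈ Set.Ioo a b),
    (∫⁻ y in Set.Ioo a b, ENNReal.ofReal |f y|) / volume (Set.Ioo a b)

open Filter Topology in
/-- A discrete Grönwall-type inequality forces power decay. -/
theorem mul_div_rpow_le_of_forall_mul_one_add_le {φ : ℝ → ℝ} {p s t : ℝ} (hp : 0 ≤ p) (hs : 0 < s)
    (hst : s ≤ t) (hφ : ∀ x, 0 ≤ φ x)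
    (h : ∀ x y, s ≤ x → x ≤ y → φ y * (1 + p * ((y - x) / y)) ≤ φ x) :
    φ t * (t / s) ^ p ≤ φ s := by
  have ht : 0 < t := hs.trans_le hst
  set x := Real.log (t / s) with hx
  have hx0 : 0 ≤ x := Real.log_nonneg ((one_le_div hs).2 hst)
  have iter : ∀ u : ℝ, 0 ≤ u → ∀ n : ℕ,
      φ (s * Real.exp (n * u)) * (1 + p * (u / (1 + u))) ^ n ≤ φ s := by
    intro u hu n
    induction n with
    | zero => simp
    | succ n ih =>
      refine le_trans ?_ ih
      have hg : 0 ≤ 1 + p * (u / (1 + u)) := by positivity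
      rw [pow_succ', ← mul_assoc]
      refine mul_le_mul_of_nonneg_right ?_ (pow_nonneg hg n)
      have hE : Real.exp ((n + 1 : ℕ) * u) = Real.exp (n * u) * Real.exp u := by
        rw [← Real.exp_add]; push_cast; ring_nf
      have h1 : 1 ≤ Real.exp (n * u) := Real.one_le_exp (by positivity)
      have h2 : u + 1 ≤ Real.exp u := Real.add_one_le_exp u
      have key := h (s * Real.exp (n * u)) (s * Real.exp ((n + 1 : ℕ) * u))
        (le_mul_of_one_le_right hs.le h1) (by
          rw [hE, ← mul_assoc]
          exact le_mul_of_one_le_right (by positivity) (by linarith))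
      have hq : (s * Real.exp ((n + 1 : ℕ) * u) - s * Real.exp (n * u)) /
          (s * Real.exp ((n + 1 : ℕ) * u)) = (Real.exp u - 1) / Real.exp u := by
        rw [hE]; field_simp
      rw [hq] at key
      refine le_trans (mul_le_mul_of_nonneg_left
        (add_le_add le_rfl (mul_le_mul_of_nonneg_left ?_ hp)) (hφ _)) key
      rw [div_le_div_iff₀ (by linarith) (Real.exp_pos u)]
      nlinarith
  have hlim : Tendsto (fun n : ℕ => φ t * (1 + p * (x / n / (1 + x / n))) ^ n) atTop
      (𝓝 (φ t * Real.exp (p * x))) := by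
    refine (Real.tendsto_one_add_pow_exp_of_tendsto ?_).const_mul _
    have h0 : Tendsto (fun n : ℕ => p * x / (1 + x / n)) atTop (𝓝 (p * x / (1 + 0))) :=
      tendsto_const_nhds.div (tendsto_const_nhds.add (tendsto_const_div_atTop_nhds_zero_nat x))
        (by norm_num)
    rw [add_zero, div_one] at h0
    refine h0.congr' ?_
    filter_upwards [eventually_ge_atTop 1] with n hn
    have : (0 : ℝ) < n := by exact_mod_cast hn
    field_simp
  have hpow : (t / s) ^ p = Real.exp (p * x) := by
    rw [Real.rpow_def_of_pos (by positivity), mul_comm]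
  rw [hpow]
  refine le_of_tendsto hlim ?_
  filter_upwards [eventually_ge_atTop 1] with n hn
  have hnpos : (0 : ℝ) < n := by exact_mod_cast hn
  have := iter (x / n) (by positivity) n
  rwa [mul_div_cancel₀ _ hnpos.ne', hx, Real.exp_log (by positivity), mul_div_cancel₀ _ hs.ne',
    ← hx] at this

/-- Sharp weak-type bound for an abstract distribution function `m` with tail integral `φ`. -/
theorem mul_rpow_le_of_tail_le {φ m : ℝ → ℝ} {δ c A t : ℝ} (hδ : 1 < δ) (hc : 0 < c)
    (hcA : c ≤ A) (ht : 0 < t) (hφ : ∀ x, 0 ≤ φ x) (hm : ∀ x, 0 ≤ m x) (hm1 : ∀ x, m x ≤ 1)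
    (hφc : φ c = A - c)
    (hdiff : ∀ x y, 0 ≤ x → x ≤ y → φ y + (y - x) * m y ≤ φ x)
    (htail : ∀ x, c ≤ x → φ x ≤ (δ - 1) * (x * m x)) :
    t * m t ^ (1 / (δ / (δ - 1))) ≤ A := by
  have hA : 0 < A := hc.trans_le hcA
  have hd : 0 < δ - 1 := by linarith
  set r := δ / (δ - 1) with hr
  have hr1 : 1 < r := by rw [hr, one_lt_div hd]; linarith
  have hr0 : 0 < r := by linarith
  rcases le_or_gt t A with htA | htA
  · calc t * m t ^ (1 / r) ≤ t * 1 := by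
          gcongr; exact Real.rpow_le_one (hm t) (hm1 t) (by positivity)
      _ ≤ A := by linarith
  suffices H : t ^ r * m t ≤ A ^ r by
    have := Real.rpow_le_rpow (by have := hm t; positivity) H (by positivity : 0 ≤ 1 / r)
    rwa [Real.mul_rpow (by positivity) (hm t), ← Real.rpow_mul ht.le, ← Real.rpow_mul hA.le,
      mul_one_div_cancel hr0.ne', Real.rpow_one, Real.rpow_one] at this
  rcases le_or_gt t (δ * c) with htc | htc
  · have h1 : (t - c) * m t ≤ A - c := by
      have := hdiff c t hc.le (by linarith); linarith [hφ t]
    have h2 : 1 + r * (A / t - 1) ≤ (A / t) ^ r := by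
      have := one_add_mul_self_le_rpow_one_add
        (by have : 0 < A / t := by positivity
            linarith : (-1 : ℝ) ≤ A / t - 1) hr1.le
      simpa using this
    have htc0 : 0 < t - c := by linarith
    have h3 : (A - c) / (t - c) ≤ 1 + r * (A / t - 1) := by
      have hrt : r * (t - c) ≤ t := by
        rw [hr, div_mul_eq_mul_div, div_le_iff₀ hd]; nlinarith
      have e : 1 + r * (A / t - 1) - (A - c) / (t - c) =
          (t - A) * (t - r * (t - c)) / (t * (t - c)) := by
        field_simp; ring
      have : 0 ≤ (t - A) * (t - r * (t - c)) / (t * (t - c)) :=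
        div_nonneg (mul_nonneg (by linarith) (by linarith)) (by positivity)
      linarith
    have h4 : m t ≤ (A / t) ^ r := by
      refine le_trans ?_ (h3.trans h2)
      rw [le_div_iff₀ htc0]; linarith
    rw [Real.div_rpow hA.le ht.le, le_div_iff₀ (by positivity)] at h4
    linarith
  · set p := 1 / (δ - 1) with hp
    have hp0 : 0 < p := by positivity
    have hrp : r = p + 1 := by rw [hr, hp]; field_simp; ring
    have hcs : c ≤ t / δ := by rw [le_div_iff₀ (by linarith)]; linarith
    have h1 : (t - t / δ) * m t ≤ φ (t / δ) := by
      have := hdiff (t / δ) t (by positivity) (div_le_self ht.le hδ.le)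
      linarith [hφ t]
    have h2 : φ (t / δ) * (t / δ / c) ^ p ≤ A - c := by
      rw [← hφc]
      refine mul_div_rpow_le_of_forall_mul_one_add_le hp0.le hc hcs hφ fun x y hx hxy => ?_
      have hy : 0 < y := by linarith
      have h3 := htail y (by linarith)
      have h4 := hdiff x y (by linarith) hxy
      have h5 : p * ((y - x) / y) * φ y ≤ (y - x) * m y := by
        calc p * ((y - x) / y) * φ y ≤ p * ((y - x) / y) * ((δ - 1) * (y * m y)) := by
              have : 0 ≤ (y - x) / y := div_nonneg (by linarith) hy.le
              gcongr
          _ = (y - x) * m y := by rw [hp]; field_simp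
      linarith
    have h6 : (t - t / δ) * m t * (t / δ / c) ^ p ≤ A - c :=
      le_trans (by gcongr) h2
    have h7 : 1 + r * (A / (δ * c) - 1) ≤ (A / (δ * c)) ^ r := by
      have := one_add_mul_self_le_rpow_one_add
        (by have : 0 < A / (δ * c) := by positivity
            linarith : (-1 : ℝ) ≤ A / (δ * c) - 1) hr1.le
      simpa using this
    have h8 : A / c - 1 ≤ (δ - 1) * (A / (δ * c)) ^ r := by
      refine le_trans (le_of_eq ?_) (mul_le_mul_of_nonneg_left h7 hd.le)
      rw [hr]; field_simp; ring
    have h9 : (t / (δ * c)) ^ r * m t ≤ (A / (δ * c)) ^ r := by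
      have e1 : (t / (δ * c)) ^ r = (t / δ / c) ^ p * (t / (δ * c)) := by
        rw [hrp, Real.rpow_add_one (by positivity), div_div]
      have e2 : (t - t / δ) * m t * (t / δ / c) ^ p
          = ((t / (δ * c)) ^ r * m t) * ((δ - 1) * c) := by
        rw [e1]; field_simp
      rw [e2] at h6
      have h10 : ((t / (δ * c)) ^ r * m t) * (δ - 1) ≤ A / c - 1 := by
        rw [div_sub_one hc.ne', le_div_iff₀ hc]; linarith
      have := h10.trans h8
      rw [mul_comm _ (δ - 1)] at this
      exact le_of_mul_le_mul_left this hd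
    have hδc : 0 < δ * c := by positivity
    rw [Real.div_rpow ht.le hδc.le, Real.div_rpow hA.le hδc.le, div_mul_eq_mul_div,
      div_le_div_iff_of_pos_right (by positivity)] at h9
    exact h9

theorem lt_M1_iff {f : ℝ → ℝ} {x : ℝ} {t : ℝ≥0∞} :
    t < M1 f x ↔ ∃ a b, x ∈ Ioo a b ∧
      t < (∫⁻ y in Ioo a b, ENNReal.ofReal |f y|) / volume (Ioo a b) := by
  simp only [M1, lt_iSup_iff]
  exact ⟨fun ⟨a, b, _, hx, h⟩ => ⟨a, b, hx, h⟩, fun ⟨a, b, hx, h⟩ => ⟨a, b, hx.1.trans hx.2, hx, h⟩⟩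

theorem average_le_M1 (f : ℝ → ℝ) {x a b : ℝ} (hx : x ∈ Ioo a b) :
    (∫⁻ y in Ioo a b, ENNReal.ofReal |f y|) / volume (Ioo a b) ≤ M1 f x :=
  le_of_forall_lt fun _ ht => lt_M1_iff.2 ⟨a, b, hx, ht⟩

theorem lowerSemicontinuous_M1 (f : ℝ → ℝ) : LowerSemicontinuous (M1 f) := by
  intro x t ht
  obtain ⟨a, b, hx, h⟩ := lt_M1_iff.1 ht
  filter_upwards [Ioo_mem_nhds hx.1 hx.2] with z hz
  exact lt_M1_iff.2 ⟨a, b, hz, h⟩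

theorem lintegral_Ioo_indicator (w : ℝ → ℝ) (a b : ℝ) (K : Set ℝ) :
    ∫⁻ y in K, ENNReal.ofReal |(Ioo a b).indicator w y| =
      ∫⁻ y in Ioo a b ∩ K, ENNReal.ofReal |w y| := by
  rw [← setLIntegral_indicator measurableSet_Ioo]
  congr 1 with y
  by_cases hy : y ∈ Ioo a b <;> simp [hy]

/-- The superlevel set of the localized maximal function. -/
def superlevel (w : ℝ → ℝ) (a b : ℝ) (s : ℝ≥0∞) : Set ℝ :=
  {x ∈ Ioo a b | s < M1 ((Ioo a b).indicator w) x}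

theorem isOpen_superlevel (w : ℝ → ℝ) (a b : ℝ) (s : ℝ≥0∞) : IsOpen (superlevel w a b s) :=
  isOpen_Ioo.inter ((lowerSemicontinuous_M1 _).isOpen_preimage s)

/-- On a component of its superlevel set, the localized maximal function only sees the weight on
that component. -/
theorem M1_indicator_le_of_component {w : ℝ → ℝ} {a b c d : ℝ} {s : ℝ≥0∞}
    (hsub : Ioo c d ⊆ superlevel w a b s)
    (hmax : ∀ K : Set ℝ, IsPreconnected K → K ⊆ superlevel w a b s → (K ∩ Ioo c d).Nonempty →
      K ⊆ Ioo c d) {x : ℝ} (hx : x ∈ Ioo c d) :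
    M1 ((Ioo a b).indicator w) x ≤ M1 ((Ioo c d).indicator w) x := by
  have hxE := hsub hx
  refine le_of_forall_lt fun t ht => ?_
  obtain ⟨k, l, hkl, h⟩ := lt_M1_iff.1 (max_lt ht hxE.2)
  have hinter : Ioo a b ∩ Ioo k l = Ioo (a ⊔ k) (b ⊓ l) := Ioo_inter_Ioo
  have hxK : x ∈ Ioo (a ⊔ k) (b ⊓ l) := hinter ▸ ⟨hxE.1, hkl⟩
  have hlt : max t s <
      (∫⁻ y in Ioo (a ⊔ k) (b ⊓ l), ENNReal.ofReal |w y|) / volume (Ioo (a ⊔ k) (b ⊓ l)) := by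
    rw [lintegral_Ioo_indicator, hinter] at h
    exact h.trans_le (ENNReal.div_le_div_left
      (measure_mono (hinter ▸ inter_subset_right)) _)
  have hKI : Ioo (a ⊔ k) (b ⊓ l) ⊆ Ioo a b := hinter ▸ inter_subset_left
  have hKE : Ioo (a ⊔ k) (b ⊓ l) ⊆ superlevel w a b s := fun z hz =>
    ⟨hKI hz, lt_M1_iff.2 ⟨_, _, hz, by
      rw [lintegral_Ioo_indicator, inter_eq_right.2 hKI]
      exact (le_max_right _ _).trans_lt hlt⟩⟩
  have hKJ := hmax _ isPreconnected_Ioo hKE ⟨x, hxK, hx⟩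
  refine lt_M1_iff.2 ⟨_, _, hxK, ?_⟩
  rw [lintegral_Ioo_indicator, inter_eq_right.2 hKJ]
  exact (le_max_left _ _).trans_lt hlt

theorem lintegral_Ioo_le_of_M1_le {w : ℝ → ℝ} {a b k l x : ℝ} {s : ℝ≥0∞}
    (hkl : Ioo k l ⊆ Ioo a b) (hx : x ∈ Ioo k l)
    (h : M1 ((Ioo a b).indicator w) x ≤ s) :
    ∫⁻ y in Ioo k l, ENNReal.ofReal |w y| ≤ s * ENNReal.ofReal (l - k) := by
  have h1 := (average_le_M1 ((Ioo a b).indicator w) hx).trans h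
  rw [lintegral_Ioo_indicator, inter_eq_right.2 hkl, Real.volume_Ioo] at h1
  have : 0 < l - k := sub_pos.2 (hx.1.trans hx.2)
  rwa [ENNReal.div_le_iff (by simpa using this) ofReal_ne_top] at h1

/-- The average of the weight over a component of the superlevel set is at most the level. -/
theorem lintegral_component_le {w : ℝ → ℝ} {a b c d : ℝ} {s : ℝ} (hs : 0 ≤ s) (hcd : c < d)
    (hI : ∫⁻ y in Ioo a b, ENNReal.ofReal |w y| ≤ ENNReal.ofReal s * ENNReal.ofReal (b - a))
    (hsub : Ioo c d ⊆ superlevel w a b (ENNReal.ofReal s))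
    (hmax : ∀ K : Set ℝ, IsPreconnected K → K ⊆ superlevel w a b (ENNReal.ofReal s) →
      (K ∩ Ioo c d).Nonempty → K ⊆ Ioo c d) :
    ∫⁻ y in Ioo c d, ENNReal.ofReal |w y| ≤ ENNReal.ofReal s * ENNReal.ofReal (d - c) := by
  have hJI : Ioo c d ⊆ Ioo a b := hsub.trans fun x hx => hx.1
  obtain ⟨hac, hdb⟩ := (Ioo_subset_Ioo_iff hcd).1 hJI
  have hne : (Ioo c d).Nonempty := nonempty_Ioo.2 hcd
  have hεlim : ∀ W : ℝ≥0∞, ∀ r > 0, (∀ ε, 0 < ε → ε < r → W ≤ ENNReal.ofReal s *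
      ENNReal.ofReal (d - c + ε)) → W ≤ ENNReal.ofReal s * ENNReal.ofReal (d - c) := by
    intro W r hr h
    have hc : Continuous fun ε : ℝ => ENNReal.ofReal (s * (d - c + ε)) :=
      ENNReal.continuous_ofReal.comp (by fun_prop)
    have hlim := (hc.tendsto 0).mono_left (nhdsWithin_le_nhds (s := Ioi 0))
    rw [add_zero, ENNReal.ofReal_mul hs] at hlim
    refine ge_of_tendsto hlim ?_
    filter_upwards [Ioo_mem_nhdsGT hr] with ε hε
    rw [ENNReal.ofReal_mul hs]
    exact h ε hε.1 hε.2
  rcases hac.lt_or_eq with hac | rfl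
  · have hcI : c ∈ Ioo a b := ⟨hac, hcd.trans_le hdb⟩
    have hcE : M1 ((Ioo a b).indicator w) c ≤ ENNReal.ofReal s := by
      by_contra! hlt
      have := hmax (Ico c d) isPreconnected_Ico
        (by rw [← Ioo_insert_left hcd]; exact insert_subset ⟨hcI, hlt⟩ hsub)
        (hne.mono fun x hx => ⟨Ioo_subset_Ico_self hx, hx⟩)
      exact lt_irrefl c (this (left_mem_Ico.2 hcd)).1
    refine hεlim _ (c - a) (by linarith) fun ε hε hεr => ?_
    have := lintegral_Ioo_le_of_M1_le (k := c - ε) (l := d)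
      (Ioo_subset_Ioo (by linarith) hdb) ⟨by linarith, hcd⟩ hcE
    rw [show d - c + ε = d - (c - ε) by ring]
    exact (lintegral_mono_set (Ioo_subset_Ioo (by linarith) le_rfl)).trans this
  rcases hdb.lt_or_eq with hdb | rfl
  · have hdI : d ∈ Ioo a b := ⟨hcd, hdb⟩
    have hdE : M1 ((Ioo a b).indicator w) d ≤ ENNReal.ofReal s := by
      by_contra! hlt
      have := hmax (Ioc a d) isPreconnected_Ioc
        (by rw [← Ioo_insert_right hcd]; exact insert_subset ⟨hdI, hlt⟩ hsub)
        (hne.mono fun x hx => ⟨Ioo_subset_Ioc_self hx, hx⟩)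
      exact lt_irrefl d (this (right_mem_Ioc.2 hcd)).2
    refine hεlim _ (b - d) (by linarith) fun ε hε hεr => ?_
    have := lintegral_Ioo_le_of_M1_le (k := a) (l := d + ε)
      (Ioo_subset_Ioo le_rfl (by linarith)) ⟨hcd, by linarith⟩ hdE
    rw [show d - a + ε = d + ε - a by ring]
    exact (lintegral_mono_set (Ioo_subset_Ioo le_rfl (by linarith))).trans this
  · exact hI

theorem IsOpen.exists_eq_Ioo_of_isPreconnected {U : Set ℝ} (ho : IsOpen U) (hc : IsPreconnected U)
    (hne : U.Nonempty) (hb : Bornology.IsBounded U) : ∃ c d, c < d ∧ U = Ioo c d := by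
  have hba := hb.bddAbove
  have hbb := hb.bddBelow
  have key : U = Ioo (sInf U) (sSup U) := by
    refine Subset.antisymm (fun x hx => ?_)
      (IsConnected.Ioo_csInf_csSup_subset ⟨hne, hc⟩ hbb hba)
    obtain ⟨l, u, hlu, h⟩ := mem_nhds_iff_exists_Ioo_subset.1 (ho.mem_nhds hx)
    obtain ⟨y, hy⟩ := nonempty_Ioo.2 hlu.1
    obtain ⟨z, hz⟩ := nonempty_Ioo.2 hlu.2
    exact ⟨(csInf_le hbb (h ⟨hy.1, hy.2.trans hlu.2⟩)).trans_lt hy.2,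
      hz.1.trans_le (le_csSup hba (h ⟨hlu.1.trans hz.1, hz.2⟩))⟩
  exact ⟨_, _, nonempty_Ioo.1 (key ▸ hne), key⟩

/-- Under the Fujii–Wilson condition, the localized maximal function is controlled on its
superlevel sets above the average of the weight. -/
theorem lintegral_superlevel_le {w : ℝ → ℝ} (hw : ∀ x, 0 ≤ w x) {δ : ℝ}
    (hFW : ∀ a b : ℝ, a < b →
      (∫⁻ x in Ioo a b, M1 ((Ioo a b).indicator w) x) ≤
        ENNReal.ofReal δ * ∫⁻ x in Ioo a b, ENNReal.ofReal (w x))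
    {a b s : ℝ} (hs : 0 ≤ s)
    (hI : ∫⁻ y in Ioo a b, ENNReal.ofReal (w y) ≤ ENNReal.ofReal s * ENNReal.ofReal (b - a)) :
    ∫⁻ x in superlevel w a b (ENNReal.ofReal s), M1 ((Ioo a b).indicator w) x ≤
      ENNReal.ofReal δ * (ENNReal.ofReal s * volume (superlevel w a b (ENNReal.ofReal s))) := by
  set E := superlevel w a b (ENNReal.ofReal s)
  have hEo : IsOpen E := isOpen_superlevel w a b _
  set S : Set (Set ℝ) := image (connectedComponentIn E) E
  have hSo : ∀ U ∈ S, IsOpen U := by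
    rintro _ ⟨x, -, rfl⟩; exact hEo.connectedComponentIn
  have hSne : ∀ U ∈ S, U.Nonempty := by
    rintro _ ⟨x, hx, rfl⟩; exact ⟨x, mem_connectedComponentIn hx⟩
  have hSd : S.PairwiseDisjoint id := by
    rintro _ ⟨x, hx, rfl⟩ _ ⟨y, hy, rfl⟩ hxy
    refine disjoint_left.2 fun z hzx hzy => hxy ?_
    exact (connectedComponentIn_eq hzx).trans (connectedComponentIn_eq hzy).symm
  have hSc : S.Countable := hSd.countable_of_isOpen hSo hSne
  have hSE : E = ⋃ U ∈ S, id U := by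
    refine Subset.antisymm (fun x hx => mem_iUnion₂.2
      ⟨_, mem_image_of_mem _ hx, mem_connectedComponentIn hx⟩) (iUnion₂_subset ?_)
    rintro _ ⟨x, -, rfl⟩; exact connectedComponentIn_subset E x
  have hSm : ∀ U ∈ S, MeasurableSet (id U) := fun U hU => (hSo U hU).measurableSet
  have key : ∀ U ∈ S, ∫⁻ x in U, M1 ((Ioo a b).indicator w) x ≤
      ENNReal.ofReal δ * (ENNReal.ofReal s * volume U) := by
    intro U hU
    obtain ⟨x, hx, hxU⟩ := id hU
    have hUE : U ⊆ E := hxU ▸ connectedComponentIn_subset E x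
    obtain ⟨c, d, hcd, rfl⟩ := (hSo U hU).exists_eq_Ioo_of_isPreconnected
      (hxU ▸ isPreconnected_connectedComponentIn) (hSne U hU)
      ((Metric.isBounded_Ioo a b).subset (hUE.trans fun x hx => hx.1))
    have hmax : ∀ K : Set ℝ, IsPreconnected K → K ⊆ E → (K ∩ Ioo c d).Nonempty →
        K ⊆ Ioo c d := by
      rintro K hK hKE ⟨z, hzK, hz⟩
      rw [← hxU] at hz ⊢
      rw [connectedComponentIn_eq hz]
      exact hK.subset_connectedComponentIn hzK hKE
    calc ∫⁻ x in Ioo c d, M1 ((Ioo a b).indicator w) x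
        ≤ ∫⁻ x in Ioo c d, M1 ((Ioo c d).indicator w) x :=
          setLIntegral_mono' measurableSet_Ioo fun x hx =>
            M1_indicator_le_of_component hUE hmax hx
      _ ≤ ENNReal.ofReal δ * ∫⁻ x in Ioo c d, ENNReal.ofReal (w x) := hFW c d hcd
      _ ≤ _ := by
          have := lintegral_component_le (w := w) hs hcd
            (by simpa only [abs_of_nonneg (hw _)] using hI) hUE hmax
          simp only [abs_of_nonneg (hw _)] at this
          rw [Real.volume_Ioo]
          gcongr
  calc ∫⁻ x in E, M1 ((Ioo a b).indicator w) x
      = ∑' U : S, ∫⁻ x in (U : Set ℝ), M1 ((Ioo a b).indicator w) x := by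
        conv_lhs => rw [hSE]
        exact lintegral_biUnion hSc hSm hSd _
    _ ≤ ∑' U : S, ENNReal.ofReal δ * (ENNReal.ofReal s * volume (U : Set ℝ)) :=
        ENNReal.tsum_le_tsum fun U => key U U.2
    _ = ENNReal.ofReal δ * (ENNReal.ofReal s * volume E) := by
        rw [ENNReal.tsum_mul_left, ENNReal.tsum_mul_left]
        conv_rhs => rw [hSE, measure_biUnion hSc hSd hSm]
        rfl

/-- Sharp endpoint weak-type reverse Hölder inequality for `A∞` weights on `ℝ`
with Fujii–Wilson constant at most `δ`, for the localized maximal function: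
`‖M(w·1_I)‖_{L^{r_w,∞}(I,dx/|I|)} ≤ ⨍_I M(w·1_I)` with `r_w = δ/(δ-1)`. -/
theorem stmt13 (w : ℝ → ℝ) (hw : ∀ x, 0 ≤ w x) (hloc : LocallyIntegrable w volume)
    (δ : ℝ) (hδ : 1 < δ)
    (hFW : ∀ a b : ℝ, a < b →
      (∫⁻ x in Set.Ioo a b, M1 ((Set.Ioo a b).indicator w) x) ≤
        ENNReal.ofReal δ * ∫⁻ x in Set.Ioo a b, ENNReal.ofReal (w x))
    (a b : ℝ) (hab : a < b) (lam : ℝ) (hlam : 0 < lam) :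
    ENNReal.ofReal lam *
        (volume {x ∈ Set.Ioo a b | ENNReal.ofReal lam < M1 ((Set.Ioo a b).indicator w) x} /
            volume (Set.Ioo a b)) ^ (1 / (δ / (δ - 1))) ≤
      (∫⁻ x in Set.Ioo a b, M1 ((Set.Ioo a b).indicator w) x) / volume (Set.Ioo a b) := by
  set F := M1 ((Ioo a b).indicator w)
  set I := Ioo a b with hIdef
  have hFm : Measurable F := (lowerSemicontinuous_M1 _).measurable
  set E : ℝ → Set ℝ := fun s => superlevel w a b (ENNReal.ofReal s)
  have hEm : ∀ s, MeasurableSet (E s) := fun s => (isOpen_superlevel w a b _).measurableSet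
  have hEI : ∀ s, E s ⊆ I := fun s x hx => hx.1
  have hL : 0 < b - a := sub_pos.2 hab
  have hvol : volume I = ENNReal.ofReal (b - a) := Real.volume_Ioo
  have hvE : ∀ s, volume.restrict I (E s) = volume (E s) := fun s => by
    rw [Measure.restrict_apply (hEm s), inter_eq_left.2 (hEI s)]
  have hvE_le : ∀ s, volume (E s) ≤ ENNReal.ofReal (b - a) := fun s =>
    hvol ▸ measure_mono (hEI s)
  have hvE_fin : ∀ s, volume (E s) ≠ ∞ := fun s => ne_top_of_le_ne_top ofReal_ne_top (hvE_le s)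
  set W := ∫⁻ x in I, ENNReal.ofReal (w x) with hW
  have hWfin : W ≠ ∞ := by
    have : IntegrableOn w I :=
      (hloc.integrableOn_isCompact isCompact_Icc).mono_set Ioo_subset_Icc_self
    exact this.lintegral_lt_top.ne
  have hFfin : ∫⁻ x in I, F x ≠ ∞ :=
    ne_top_of_le_ne_top (ENNReal.mul_ne_top ofReal_ne_top hWfin) (hFW a b hab)
  have hr : 0 < 1 / (δ / (δ - 1)) := by
    have : 0 < δ - 1 := by linarith
    positivity
  change ENNReal.ofReal lam * (volume (E lam) / volume I) ^ (1 / (δ / (δ - 1))) ≤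
    (∫⁻ x in I, F x) / volume I
  rcases eq_or_ne W 0 with hW0 | hW0
  · have h0 : ∫⁻ x in I, F x = 0 := by
      have := hFW a b hab
      rw [← hIdef, ← hW, hW0, mul_zero] at this
      exact nonpos_iff_eq_zero.1 this
    have h1 : volume (E lam) = 0 := by
      rw [← hvE]
      refine measure_mono_null (fun x hx => ?_) ((lintegral_eq_zero_iff hFm).1 h0)
      exact (pos_of_gt hx.2).ne'
    rw [h1, ENNReal.zero_div, ENNReal.zero_rpow_of_pos hr, mul_zero]
    exact zero_le
  set c := W.toReal / (b - a) with hc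
  have hc0 : 0 < c := div_pos (ENNReal.toReal_pos hW0 hWfin) hL
  have hWc : W = ENNReal.ofReal c * ENNReal.ofReal (b - a) := by
    rw [← ENNReal.ofReal_mul hc0.le, hc, div_mul_cancel₀ _ hL.ne', ENNReal.ofReal_toReal hWfin]
  have hcF : ∀ x ∈ I, ENNReal.ofReal c ≤ F x := fun x hx => by
    refine le_trans (le_of_eq ?_) (average_le_M1 _ hx)
    rw [lintegral_Ioo_indicator, inter_self]
    simp only [abs_of_nonneg (hw _)]
    rw [← hIdef, ← hW, hWc, hvol, ENNReal.mul_div_cancel_right (by simpa using hab) ofReal_ne_top]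
  set φ : ℝ → ℝ≥0∞ := fun s => ∫⁻ x in I, (F x - ENNReal.ofReal s)
  have hφfin : ∀ s, φ s ≠ ∞ := fun s =>
    ne_top_of_le_ne_top hFfin (lintegral_mono fun x => tsub_le_self)
  have hind : ∀ s (k : ℝ≥0∞), ∫⁻ x in I, (E s).indicator (fun _ => k) x = k * volume (E s) :=
    fun s k => by rw [lintegral_indicator_const (hEm s), hvE]
  have hadd : ∀ s (k : ℝ≥0∞), φ s + k * volume (E s) =
      ∫⁻ x in I, ((F x - ENNReal.ofReal s) + (E s).indicator (fun _ => k) x) := fun s k => by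
    rw [lintegral_add_left (hFm.sub_const _), hind]
  have hφc : φ c + ENNReal.ofReal c * ENNReal.ofReal (b - a) = ∫⁻ x in I, F x := by
    rw [← hvol, ← setLIntegral_const, ← lintegral_add_left (hFm.sub_const _)]
    exact setLIntegral_congr_fun measurableSet_Ioo fun x hx => tsub_add_cancel_of_le (hcF x hx)
  have hdiff : ∀ x y, 0 ≤ x → x ≤ y →
      φ y + ENNReal.ofReal (y - x) * volume (E y) ≤ φ x := by
    intro x y hx hxy
    rw [hadd]
    refine lintegral_mono fun z => ?_
    by_cases hz : z ∈ E y
    · have hyx : ENNReal.ofReal y = ENNReal.ofReal x + ENNReal.ofReal (y - x) := by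
        rw [← ENNReal.ofReal_add hx (sub_nonneg.2 hxy), add_sub_cancel]
      have hzy : ENNReal.ofReal x + ENNReal.ofReal (y - x) ≤ F z := hyx ▸ hz.2.le
      simp only [indicator_of_mem hz]
      rw [hyx, ← tsub_tsub, tsub_add_cancel_of_le]
      exact ENNReal.le_sub_of_add_le_left ofReal_ne_top hzy
    · simp only [indicator_of_notMem hz, add_zero]
      exact tsub_le_tsub_left (ENNReal.ofReal_le_ofReal hxy) _
  have htail : ∀ x, c ≤ x → φ x + ENNReal.ofReal x * volume (E x) ≤
      ENNReal.ofReal δ * (ENNReal.ofReal x * volume (E x)) := by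
    intro x hx
    have hEF : ∫⁻ z in E x, F z = ∫⁻ z in I, (E x).indicator F z := by
      rw [setLIntegral_indicator (hEm x), inter_eq_left.2 (hEI x)]
    refine le_trans ?_ (hEF.ge.trans (lintegral_superlevel_le hw hFW (hc0.le.trans hx)
      (hWc.le.trans (by gcongr))))
    rw [hadd]
    refine setLIntegral_mono' measurableSet_Ioo fun z hzI => ?_
    by_cases hz : z ∈ E x
    · simp only [indicator_of_mem hz]
      exact (tsub_add_cancel_of_le hz.2.le).le
    · have : F z ≤ ENNReal.ofReal x := not_lt.1 fun h => hz ⟨hzI, h⟩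
      simp [indicator_of_notMem hz, tsub_eq_zero_of_le this]
  set v : ℝ → ℝ := fun x => (volume (E x)).toReal
  have hvR : ∀ x, volume (E x) = ENNReal.ofReal (v x) := fun x =>
    (ENNReal.ofReal_toReal (hvE_fin x)).symm
  have hv0 : ∀ x, 0 ≤ v x := fun x => toReal_nonneg
  have hφR : ∀ x, φ x = ENNReal.ofReal (φ x).toReal := fun x =>
    (ENNReal.ofReal_toReal (hφfin x)).symm
  set A := (∫⁻ x in I, F x).toReal / (b - a) with hA
  have hAφ : (φ c).toReal + c * (b - a) = (∫⁻ x in I, F x).toReal := by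
    rw [← hφc, ENNReal.toReal_add (hφfin c) (ENNReal.mul_ne_top ofReal_ne_top ofReal_ne_top),
      ENNReal.toReal_mul, ENNReal.toReal_ofReal hc0.le, ENNReal.toReal_ofReal hL.le]
  have hcA : (φ c).toReal / (b - a) = A - c := by
    rw [hA, ← hAφ]; field_simp; ring
  have main : lam * (v lam / (b - a)) ^ (1 / (δ / (δ - 1))) ≤ A := by
    refine mul_rpow_le_of_tail_le (φ := fun x => (φ x).toReal / (b - a))
      (m := fun x => v x / (b - a)) hδ hc0 ?_ hlam (fun x => by positivity)
      (fun x => div_nonneg (hv0 x) hL.le) (fun x => ?_) hcA (fun x y hx hxy => ?_)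
      (fun x hx => ?_)
    · have : 0 ≤ (φ c).toReal / (b - a) := by positivity
      linarith
    · rw [div_le_one hL]
      exact ENNReal.toReal_le_of_le_ofReal hL.le (hvE_le x)
    · have h := hdiff x y hx hxy
      have hyx := sub_nonneg.2 hxy
      rw [hvR, hφR x, hφR y, ← ENNReal.ofReal_mul hyx,
        ← ENNReal.ofReal_add toReal_nonneg (mul_nonneg hyx (hv0 y)),
        ENNReal.ofReal_le_ofReal_iff toReal_nonneg] at h
      rw [← mul_div_assoc, ← add_div]
      gcongr
    · have h := htail x hx
      have hx0 : 0 ≤ x := hc0.le.trans hx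
      have hxv := mul_nonneg hx0 (hv0 x)
      rw [hvR, hφR x, ← ENNReal.ofReal_mul hx0, ← ENNReal.ofReal_mul (by linarith),
        ← ENNReal.ofReal_add toReal_nonneg hxv,
        ENNReal.ofReal_le_ofReal_iff (mul_nonneg (by linarith) hxv)] at h
      rw [← mul_div_assoc, ← mul_div_assoc]
      gcongr
      linarith
  rw [hvol, hvR, ← ENNReal.ofReal_toReal hFfin, ← ENNReal.ofReal_div_of_pos hL,
    ← ENNReal.ofReal_div_of_pos hL, ENNReal.ofReal_rpow_of_nonneg (div_nonneg (hv0 _) hL.le) hr.le,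
    ← ENNReal.ofReal_mul hlam.le]
  exact ENNReal.ofReal_le_ofReal main
end
end
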